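/- Let p < 0, let e_1,…,e_{2m} ∈ 𝕊^n satisfy e_{m+i} = −e_i for 1 ≤ i ≤ m, and let a_1,…,a_{2m} > 0 satisfy a_{m+i} = a_i. For x ∈ ℝ_*^m = {x ∈ ℝ^m : x_i ≥ 0} set x_{m+i} = x_i, P(x) = ∩_{i=1}^{2m} B̄_{e_i}(x_i), and Φ_p(x) = (1/p) Σ_{i=1}^{2m} a_i (e^{p x_i} − 1). Suppose V(P(x)) = V_0 > 0. Then there exists x̃ ∈ ℝ_*^m that is admissible, meaning u(P(x̃), e_i) = x̃_i for all 1 ≤ i ≤ m, such that V(P(x̃)) = V_0 and Φ_p(x̃) ≤ Φ_p(x); in fact P(x̃) = P(x). -/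

import Mathlib

noncomputable section

open Real MeasureTheory Filter Topology Set
open scoped ENNReal symmDiff

namespace Horo

/-- The Lorentzian inner product on ℝ^{n+2}:
`X·Y = Σ_{i=1}^{n+1} x_i y_i − x_{n+2} y_{n+2}`. -/
def lprod (n : ℕ) (X Y : Fin (n + 2) → ℝ) : ℝ :=
  (∑ i : Fin (n + 1), X i.castSucc * Y i.castSucc) - X (Fin.last (n + 1)) * Y (Fin.last (n + 1))

/-- The hyperboloid model ℍ^{n+1} of hyperbolic space. -/
def Hyp (n : ℕ) : Set (Fin (n + 2) → ℝ) :=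
  {X | lprod n X X = -1 ∧ 0 < X (Fin.last (n + 1))}

/-- The origin O = (0,…,0,1) of hyperbolic space. -/
def origin (n : ℕ) : Fin (n + 2) → ℝ := Fin.snoc (fun _ => 0) 1

/-- The unit sphere 𝕊^n ⊂ ℝ^{n+1}. -/
def sph (n : ℕ) : Set (Fin (n + 1) → ℝ) := {e | ∑ i, e i ^ 2 = 1}

/-- The null vector (e,1) ∈ ℝ^{n+2} associated with e ∈ 𝕊^n. -/
def dir {n : ℕ} (e : Fin (n + 1) → ℝ) : Fin (n + 2) → ℝ := Fin.snoc e 1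

/-- The geodesic distance d(X,Y) = arcosh(−X·Y) on the hyperboloid. -/
def dH (n : ℕ) (X Y : Fin (n + 2) → ℝ) : ℝ :=
  Real.log (-(lprod n X Y) + Real.sqrt ((lprod n X Y) ^ 2 - 1))

/-- The horosphere H_e(s) = {X ∈ ℍ^{n+1} : X·(e,1) = −e^s}. -/
def horoSphere (n : ℕ) (e : Fin (n + 1) → ℝ) (s : ℝ) : Set (Fin (n + 2) → ℝ) :=
  {X ∈ Hyp n | lprod n X (dir e) = -Real.exp s}

/-- The open horo-ball B_e(s) = {X ∈ ℍ^{n+1} : 0 > X·(e,1) > −e^s}. -/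
def horoBall (n : ℕ) (e : Fin (n + 1) → ℝ) (s : ℝ) : Set (Fin (n + 2) → ℝ) :=
  {X ∈ Hyp n | 0 > lprod n X (dir e) ∧ lprod n X (dir e) > -Real.exp s}

/-- The closed horo-ball B̄_e(s) = {X ∈ ℍ^{n+1} : 0 > X·(e,1) ≥ −e^s}. -/
def horoBallCl (n : ℕ) (e : Fin (n + 1) → ℝ) (s : ℝ) : Set (Fin (n + 2) → ℝ) :=
  {X ∈ Hyp n | 0 > lprod n X (dir e) ∧ lprod n X (dir e) ≥ -Real.exp s}

/-- A set Ω ⊂ ℍ^{n+1} is horospherically convex (h-convex) if it is closed and every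
relative boundary point of Ω admits a supporting horo-ball. -/
def IsHConvex (n : ℕ) (Ω : Set (Fin (n + 2) → ℝ)) : Prop :=
  Ω ⊆ Hyp n ∧ IsClosed Ω ∧
    ∀ X ∈ Ω ∩ closure (Hyp n \ Ω),
      ∃ e ∈ sph n, ∃ s : ℝ, Ω ⊆ horoBallCl n e s ∧ X ∈ horoSphere n e s

/-- The interior of a subset of the hyperboloid, relative to the hyperboloid. -/
def relInt (n : ℕ) (K : Set (Fin (n + 2) → ℝ)) : Set (Fin (n + 2) → ℝ) :=
  {X ∈ Hyp n | ∃ ε > 0, ∀ Y ∈ Hyp n, dH n X Y < ε → Y ∈ K}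

/-- A h-convex body: a compact h-convex set with nonempty (relative) interior. -/
def IsHConvexBody (n : ℕ) (K : Set (Fin (n + 2) → ℝ)) : Prop :=
  IsHConvex n K ∧ IsCompact K ∧ (relInt n K).Nonempty

/-- A h-convex polytope: a h-convex body which is a finite intersection of closed
horo-balls. -/
def IsHPolytope (n : ℕ) (P : Set (Fin (n + 2) → ℝ)) : Prop :=
  IsHConvexBody n P ∧ ∃ m : ℕ, 2 ≤ m ∧ ∃ (e : Fin m → (Fin (n + 1) → ℝ)) (u : Fin m → ℝ),
    (∀ i, e i ∈ sph n) ∧ P = ⋂ i, horoBallCl n (e i) (u i)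

/-- The horospherical support function u(K,e) = sup{log(−X·(e,1)) : X ∈ K}. -/
def suppFn (n : ℕ) (K : Set (Fin (n + 2) → ℝ)) (e : Fin (n + 1) → ℝ) : ℝ :=
  sSup ((fun X => Real.log (-(lprod n X (dir e)))) '' K)

/-- The outer parallel set K^ε = {X ∈ ℍ^{n+1} : d(K,X) ≤ ε}. -/
def outPar (n : ℕ) (K : Set (Fin (n + 2) → ℝ)) (ε : ℝ) : Set (Fin (n + 2) → ℝ) :=
  {X ∈ Hyp n | ∃ Y ∈ K, dH n Y X ≤ ε}

/-- The Hausdorff distance d_H(K,L) = inf{ε ≥ 0 : K ⊆ L^ε and L ⊆ K^ε}. -/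
def dHaus (n : ℕ) (K L : Set (Fin (n + 2) → ℝ)) : ℝ :=
  sInf {ε : ℝ | 0 ≤ ε ∧ K ⊆ outPar n L ε ∧ L ⊆ outPar n K ε}

/-- The point (sinh r · θ, cosh r) ∈ ℍ^{n+1} at distance r from O in direction θ. -/
def rpt (n : ℕ) (θ : Fin (n + 1) → ℝ) (r : ℝ) : Fin (n + 2) → ℝ :=
  Fin.snoc (fun i => Real.sinh r * θ i) (Real.cosh r)

/-- The radial function ρ(K,θ) = max{λ ≥ 0 : (sinh λ · θ, cosh λ) ∈ K}. -/
def radFn (n : ℕ) (K : Set (Fin (n + 2) → ℝ)) (θ : Fin (n + 1) → ℝ) : ℝ :=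
  sSup {r : ℝ | 0 ≤ r ∧ rpt n θ r ∈ K}

/-- R(K) = max_θ ρ(K,θ). -/
def Rmax (n : ℕ) (K : Set (Fin (n + 2) → ℝ)) : ℝ := sSup (radFn n K '' sph n)

/-- r(K) = min_θ ρ(K,θ). -/
def rmin (n : ℕ) (K : Set (Fin (n + 2) → ℝ)) : ℝ := sInf (radFn n K '' sph n)

/-- The point reflection (x_1,…,x_{n+1},x_{n+2}) ↦ (−x_1,…,−x_{n+1},x_{n+2}) about O. -/
def symMap (n : ℕ) (X : Fin (n + 2) → ℝ) : Fin (n + 2) → ℝ :=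
  fun i => if i = Fin.last (n + 1) then X i else -X i

/-- The hyperbolic (Riemannian) volume of a subset of the hyperboloid, computed via the
graph parametrization x ↦ (x, √(1+|x|²)), whose volume density is 1/√(1+|x|²). -/
def hypVol (n : ℕ) (K : Set (Fin (n + 2) → ℝ)) : ℝ :=
  ∫ x : Fin (n + 1) → ℝ,
    Set.indicator {y : Fin (n + 1) → ℝ | Fin.snoc y (Real.sqrt (1 + ∑ i, y i ^ 2)) ∈ K}
      (fun y => 1 / Real.sqrt (1 + ∑ i, y i ^ 2)) x

/-- The distance from a point X to a set P. -/
def distTo (n : ℕ) (P : Set (Fin (n + 2) → ℝ)) (X : Fin (n + 2) → ℝ) : ℝ :=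
  sInf ((fun Y => dH n Y X) '' P)

/-- The facet F(P,e) = P ∩ H_e(u(P,e)). -/
def facet (n : ℕ) (P : Set (Fin (n + 2) → ℝ)) (e : Fin (n + 1) → ℝ) :
    Set (Fin (n + 2) → ℝ) :=
  P ∩ horoSphere n e (suppFn n P e)

/-- The relative interior of the facet F(P,e) inside the horosphere H_e(u(P,e)). -/
def facetRelInt (n : ℕ) (P : Set (Fin (n + 2) → ℝ)) (e : Fin (n + 1) → ℝ) :
    Set (Fin (n + 2) → ℝ) :=
  {Y ∈ facet n P e | ∃ δ > 0, ∀ Z ∈ horoSphere n e (suppFn n P e),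
    dH n Y Z < δ → Z ∈ facet n P e}

/-- The collar 𝒫_t(P, F̊(P,e)): points at positive distance ≤ t from P whose nearest
point in P lies in the relative interior of the facet F(P,e). -/
def collar (n : ℕ) (P : Set (Fin (n + 2) → ℝ)) (e : Fin (n + 1) → ℝ) (t : ℝ) :
    Set (Fin (n + 2) → ℝ) :=
  {X ∈ Hyp n | 0 < distTo n P X ∧ distTo n P X ≤ t ∧
    ∃ Y ∈ facetRelInt n P e, ∀ Z ∈ P, dH n Y X ≤ dH n Z X}

/-- The diameter of a set with respect to a distance function, in ℝ≥0∞. -/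
def ediamWith {α : Type*} (d : α → α → ℝ) (U : Set α) : ℝ≥0∞ :=
  ⨆ (x ∈ U) (y ∈ U), ENNReal.ofReal (d x y)

/-- The (unnormalized) s-dimensional Hausdorff measure associated with a distance
function d, via the Carathéodory construction. -/
def hMeasWith {α : Type*} (d : α → α → ℝ) (s : ℕ) (A : Set α) : ℝ≥0∞ :=
  ⨆ (δ : ℝ) (_ : 0 < δ),
    ⨅ (U : ℕ → Set α) (_ : A ⊆ ⋃ i, U i) (_ : ∀ i, ediamWith d (U i) ≤ ENNReal.ofReal δ),
      ∑' i, ediamWith d (U i) ^ s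

/-- ω_n, the volume of the unit ball in ℝ^n. -/
def unitBallVol (n : ℕ) : ℝ :=
  (volume (Metric.ball (0 : EuclideanSpace ℝ (Fin n)) 1)).toReal

/-- S(P,e): the n-dimensional area of the facet F(P,e), i.e. the normalized
n-dimensional Hausdorff measure of F(P,e) with respect to the hyperbolic distance. -/
def areaFacet (n : ℕ) (P : Set (Fin (n + 2) → ℝ)) (e : Fin (n + 1) → ℝ) : ℝ :=
  (ENNReal.ofReal (unitBallVol n / 2 ^ n) * hMeasWith (dH n) n (facet n P e)).toReal


theorem lprod_symMap_self (n : ℕ) (X : Fin (n + 2) → ℝ) :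
    lprod n (symMap n X) (symMap n X) = lprod n X X := by
  simp [lprod, symMap, Fin.castSucc_ne_last]

theorem lprod_symMap_dir (n : ℕ) (X : Fin (n + 2) → ℝ) (e : Fin (n + 1) → ℝ) :
    lprod n (symMap n X) (dir e) = lprod n X (dir (-e)) := by
  simp [lprod, symMap, dir, Fin.castSucc_ne_last]

theorem lprod_origin_dir (n : ℕ) (e : Fin (n + 1) → ℝ) :
    lprod n (origin n) (dir e) = -1 := by
  simp [lprod, origin, dir]

theorem origin_mem_hyp (n : ℕ) : origin n ∈ Hyp n := by
  simp [Hyp, lprod, origin]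

theorem symMap_mem_hyp {n : ℕ} {X : Fin (n + 2) → ℝ} (hX : X ∈ Hyp n) : symMap n X ∈ Hyp n :=
  ⟨(lprod_symMap_self n X).trans hX.1, by simpa [symMap] using hX.2⟩

theorem symMap_mem_horoBallCl {n : ℕ} {X : Fin (n + 2) → ℝ} {e : Fin (n + 1) → ℝ} {s : ℝ}
    (hX : X ∈ horoBallCl n (-e) s) : symMap n X ∈ horoBallCl n e s :=
  ⟨symMap_mem_hyp hX.1, by simpa only [lprod_symMap_dir] using hX.2⟩

theorem origin_mem_horoBallCl (n : ℕ) (e : Fin (n + 1) → ℝ) {s : ℝ} (hs : 0 ≤ s) :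
    origin n ∈ horoBallCl n e s := by
  refine ⟨origin_mem_hyp n, ?_, ?_⟩
  · rw [lprod_origin_dir]; norm_num
  · rw [lprod_origin_dir]
    linarith [Real.one_le_exp hs]

theorem horoBallCl_mono (n : ℕ) (e : Fin (n + 1) → ℝ) {s t : ℝ} (h : s ≤ t) :
    horoBallCl n e s ⊆ horoBallCl n e t := fun _ hX =>
  ⟨hX.1, hX.2.1, by linarith [hX.2.2, Real.exp_le_exp.2 h]⟩

theorem log_le_of_mem_horoBallCl {n : ℕ} {X : Fin (n + 2) → ℝ} {e : Fin (n + 1) → ℝ} {s : ℝ}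
    (hX : X ∈ horoBallCl n e s) : Real.log (-(lprod n X (dir e))) ≤ s :=
  (Real.log_le_iff_le_exp (by linarith [hX.2.1])).2 (by linarith [hX.2.2])

theorem mem_horoBallCl_of_log_le {n : ℕ} {X : Fin (n + 2) → ℝ} {e : Fin (n + 1) → ℝ} {s t : ℝ}
    (hX : X ∈ horoBallCl n e s) (h : Real.log (-(lprod n X (dir e))) ≤ t) :
    X ∈ horoBallCl n e t :=
  ⟨hX.1, hX.2.1, by
    linarith [(Real.log_le_iff_le_exp (by linarith [hX.2.1])).1 h]⟩

theorem bddAbove_log_image {n : ℕ} {K : Set (Fin (n + 2) → ℝ)} {e : Fin (n + 1) → ℝ} {s : ℝ}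
    (hK : K ⊆ horoBallCl n e s) :
    BddAbove ((fun X => Real.log (-(lprod n X (dir e)))) '' K) :=
  ⟨s, by rintro _ ⟨X, hX, rfl⟩; exact log_le_of_mem_horoBallCl (hK hX)⟩

theorem suppFn_le {n : ℕ} {K : Set (Fin (n + 2) → ℝ)} {e : Fin (n + 1) → ℝ} {s : ℝ}
    (hne : K.Nonempty) (hK : K ⊆ horoBallCl n e s) : suppFn n K e ≤ s :=
  csSup_le (hne.image _) (by rintro _ ⟨X, hX, rfl⟩; exact log_le_of_mem_horoBallCl (hK hX))

theorem log_le_suppFn {n : ℕ} {K : Set (Fin (n + 2) → ℝ)} {e : Fin (n + 1) → ℝ} {s : ℝ}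
    (hK : K ⊆ horoBallCl n e s) {X : Fin (n + 2) → ℝ} (hX : X ∈ K) :
    Real.log (-(lprod n X (dir e))) ≤ suppFn n K e :=
  le_csSup (bddAbove_log_image hK) ⟨X, hX, rfl⟩

/-- For `p < 0` and an even configuration of normals `±e_i` with even weights `a_i`,
any `x ∈ ℝ_*^m` with `V(P(x)) = V₀ > 0` can be replaced by an admissible `x̃ ∈ ℝ_*^m`
(meaning `u(P(x̃),e_i) = x̃_i` for all `i`) with `V(P(x̃)) = V₀` and `Φ_p(x̃) ≤ Φ_p(x)`;
in fact `P(x̃) = P(x)`. -/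
theorem exists_admissible (n m : ℕ) (hn : 1 ≤ n) (hm : 1 ≤ m) (p : ℝ) (hp : p < 0)
    (e : Fin m → (Fin (n + 1) → ℝ)) (he : ∀ i, e i ∈ sph n)
    (a : Fin m → ℝ) (ha : ∀ i, 0 < a i)
    (x : Fin m → ℝ) (hx : ∀ i, 0 ≤ x i) (V₀ : ℝ) (hV₀ : 0 < V₀)
    (hvol : hypVol n (⋂ i, (horoBallCl n (e i) (x i) ∩ horoBallCl n (-(e i)) (x i)))
      = V₀) :
    ∃ x' : Fin m → ℝ, (∀ i, 0 ≤ x' i) ∧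
      (∀ i, suppFn n (⋂ i, (horoBallCl n (e i) (x' i) ∩ horoBallCl n (-(e i)) (x' i)))
        (e i) = x' i) ∧
      hypVol n (⋂ i, (horoBallCl n (e i) (x' i) ∩ horoBallCl n (-(e i)) (x' i))) = V₀ ∧
      (1 / p) * ∑ i, (a i * (Real.exp (p * x' i) - 1) + a i * (Real.exp (p * x' i) - 1))
        ≤ (1 / p) * ∑ i, (a i * (Real.exp (p * x i) - 1) + a i * (Real.exp (p * x i) - 1)) ∧
      (⋂ i, (horoBallCl n (e i) (x' i) ∩ horoBallCl n (-(e i)) (x' i)))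
        = ⋂ i, (horoBallCl n (e i) (x i) ∩ horoBallCl n (-(e i)) (x i)) := by
  set P : Set (Fin (n + 2) → ℝ) :=
    ⋂ i, (horoBallCl n (e i) (x i) ∩ horoBallCl n (-(e i)) (x i)) with hP
  have hsub : ∀ i, P ⊆ horoBallCl n (e i) (x i) := fun i X hX => (mem_iInter.1 hX i).1
  have hO : origin n ∈ P := mem_iInter.2 fun i =>
    ⟨origin_mem_horoBallCl n _ (hx i), origin_mem_horoBallCl n _ (hx i)⟩
  have hsym : ∀ X ∈ P, symMap n X ∈ P := fun X hX => mem_iInter.2 fun i =>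
    ⟨symMap_mem_horoBallCl (mem_iInter.1 hX i).2,
      symMap_mem_horoBallCl (by simpa using (mem_iInter.1 hX i).1)⟩
  have hle : ∀ i, suppFn n P (e i) ≤ x i := fun i => suppFn_le ⟨_, hO⟩ (hsub i)
  have hPP : (⋂ i, (horoBallCl n (e i) (suppFn n P (e i)) ∩
      horoBallCl n (-(e i)) (suppFn n P (e i)))) = P := by
    refine Subset.antisymm (iInter_mono fun i => inter_subset_inter
      (horoBallCl_mono n _ (hle i)) (horoBallCl_mono n _ (hle i))) fun X hX => ?_
    refine mem_iInter.2 fun i => ⟨?_, ?_⟩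
    · exact mem_horoBallCl_of_log_le (hsub i hX) (log_le_suppFn (hsub i) hX)
    · refine mem_horoBallCl_of_log_le (mem_iInter.1 hX i).2 ?_
      rw [← lprod_symMap_dir]
      exact log_le_suppFn (hsub i) (hsym X hX)
  refine ⟨fun i => suppFn n P (e i), fun i => ?_, fun i => ?_, ?_, ?_, hPP⟩
  · simpa [lprod_origin_dir] using log_le_suppFn (hsub i) hO
  · rw [hPP]
  · rw [hPP, hvol]
  · refine mul_le_mul_of_nonpos_left (Finset.sum_le_sum fun i _ => ?_)
      (one_div_neg.2 hp).le
    have h : Real.exp (p * x i) ≤ Real.exp (p * suppFn n P (e i)) :=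
      Real.exp_le_exp.2 (mul_le_mul_of_nonpos_left (hle i) hp.le)
    have := mul_le_mul_of_nonneg_left (sub_le_sub_right h 1) (ha i).le
    exact add_le_add this this

end Horo
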